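/- Let d > 1 and S = Z[y_0, …, y_n]/(y_i^d - 1). The principal ideal of S generated by (x_0 - 1)(x_1 - 1)⋯(x_n - 1), where x_0 = y_0 and x_k = y_k y_{k-1}^{-1}, is a free Z-module of rank (d-1)^{n+1}. -/

import Mathlib

/-- `S = ℤ[y_0,…,y_n]/(y_0^d - 1, …, y_n^d - 1)`, the group ring of `(μ_d)^{n+1}`. -/
abbrev Sring (d n : ℕ) : Type :=
  MvPolynomial (Fin (n + 1)) ℤ ⧸
    Ideal.span (Set.range fun i : Fin (n + 1) =>
      (MvPolynomial.X i : MvPolynomial (Fin (n + 1)) ℤ) ^ d - 1)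

/-- The class of the variable `y_i` in `S`. -/
noncomputable def yS (d n : ℕ) (i : Fin (n + 1)) : Sring d n :=
  Ideal.Quotient.mk _ (MvPolynomial.X i)

/-- `(x_0 - 1)(x_1 - 1)⋯(x_n - 1)` where `x_0 = y_0` and `x_k = y_k y_{k-1}^{-1}`
(with `y^{-1} = y^{d-1}` since `y^d = 1`). -/
noncomputable def xprodS (d n : ℕ) : Sring d n :=
  (yS d n 0 - 1) * ∏ i : Fin n, (yS d n i.succ * (yS d n i.castSucc) ^ (d - 1) - 1)


/-- `x_0 = y_0`, `x_k = y_k y_{k-1}^{-1}`. -/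
noncomputable def xS (d n : ℕ) : Fin (n + 1) → Sring d n :=
  Fin.cases (yS d n 0) (fun i => yS d n i.succ * (yS d n i.castSucc) ^ (d - 1))

theorem xprodS_eq (d n : ℕ) : xprodS d n = ∏ i, (xS d n i - 1) := by
  rw [Fin.prod_univ_succ]; rfl

theorem yS_pow (d n : ℕ) (i : Fin (n + 1)) : yS d n i ^ d = 1 := by
  rw [yS, ← map_pow, ← sub_eq_zero, ← map_one (Ideal.Quotient.mk _), ← map_sub,
    Ideal.Quotient.eq_zero_iff_mem]
  exact Ideal.subset_span ⟨i, rfl⟩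

theorem xS_pow (d n : ℕ) (i : Fin (n + 1)) : xS d n i ^ d = 1 := by
  refine Fin.cases ?_ (fun i => ?_) i
  · exact yS_pow d n 0
  · change (yS d n i.succ * (yS d n i.castSucc) ^ (d - 1)) ^ d = 1
    rw [mul_pow, yS_pow, ← pow_mul, mul_comm (d - 1), pow_mul, yS_pow, one_pow, one_mul]

theorem yS_succ (d n : ℕ) (hd : 1 < d) (i : Fin n) :
    yS d n i.succ = yS d n i.castSucc * xS d n i.succ := by
  change _ = yS d n i.castSucc * (yS d n i.succ * (yS d n i.castSucc) ^ (d - 1))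
  have h := yS_pow d n i.castSucc
  obtain ⟨e, rfl⟩ : ∃ e, d = e + 1 := ⟨d - 1, by omega⟩
  rw [Nat.add_sub_cancel]
  rw [pow_succ] at h
  linear_combination -yS (e+1) n i.succ * h

theorem adjoin_xS (d n : ℕ) (hd : 1 < d) :
    Algebra.adjoin ℤ (Set.range (xS d n)) = ⊤ := by
  have hy : ∀ i, yS d n i ∈ Algebra.adjoin ℤ (Set.range (xS d n)) := by
    intro i
    induction i using Fin.induction with
    | zero => exact Algebra.subset_adjoin ⟨0, rfl⟩
    | succ i ih =>
      rw [yS_succ d n hd]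
      exact mul_mem ih (Algebra.subset_adjoin ⟨_, rfl⟩)
  rw [eq_top_iff]
  rintro s -
  obtain ⟨p, rfl⟩ := Ideal.Quotient.mk_surjective s
  induction p using MvPolynomial.induction_on with
  | C a =>
    have : (MvPolynomial.C a : MvPolynomial (Fin (n+1)) ℤ) = (a : MvPolynomial (Fin (n+1)) ℤ) := by
      simp
    rw [this, map_intCast]
    exact intCast_mem _ a
  | add p q hp hq => rw [map_add]; exact add_mem hp hq
  | mul_X p i hp => rw [map_mul]; exact mul_mem hp (hy i)

/-- The proposed basis elements. -/
noncomputable def bS (d n : ℕ) (a : Fin (n + 1) → Fin (d - 1)) : Sring d n :=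
  xprodS d n * ∏ i, xS d n i ^ (a i : ℕ)

theorem xprod_geom (d n : ℕ) (i : Fin (n + 1)) :
    xprodS d n * ∑ k ∈ Finset.range d, xS d n i ^ k = 0 := by
  rw [xprodS_eq, ← Finset.prod_erase_mul _ _ (Finset.mem_univ i), mul_assoc, mul_geom_sum,
    xS_pow, sub_self, mul_zero]

theorem prod_update (d n : ℕ) (a : Fin (n + 1) → Fin (d - 1)) (i : Fin (n + 1)) (k : Fin (d - 1)) :
    bS d n (Function.update a i k) =
      xprodS d n * (xS d n i ^ (k : ℕ) *
        ∏ j ∈ Finset.univ.erase i, xS d n j ^ (a j : ℕ)) := by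
  rw [bS, ← Finset.mul_prod_erase _ _ (Finset.mem_univ i), Function.update_self]
  congr 2
  refine Finset.prod_congr rfl fun j hj => ?_
  rw [Function.update_of_ne (Finset.ne_of_mem_erase hj)]

theorem xS_mul_mem (d n : ℕ) (hd : 1 < d) (i : Fin (n + 1)) (m : Sring d n)
    (hm : m ∈ Submodule.span ℤ (Set.range (bS d n))) :
    xS d n i * m ∈ Submodule.span ℤ (Set.range (bS d n)) := by
  induction hm using Submodule.span_induction with
  | zero => simp
  | add p q _ _ hp hq => rw [mul_add]; exact add_mem hp hq
  | smul c p _ hp => rw [mul_smul_comm]; exact Submodule.smul_mem _ _ hp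
  | mem p hp =>
    obtain ⟨a, rfl⟩ := hp
    have ha := prod_update d n a i (a i)
    rw [Function.update_eq_self] at ha
    set Q := ∏ j ∈ Finset.univ.erase i, xS d n j ^ (a j : ℕ) with hQ
    by_cases h : (a i : ℕ) + 1 < d - 1
    · have : xS d n i * bS d n a = bS d n (Function.update a i ⟨a i + 1, h⟩) := by
        rw [prod_update, ha]
        simp only [pow_succ]
        ring
      rw [this]
      exact Submodule.subset_span ⟨_, rfl⟩
    · have h1 : (a i : ℕ) + 1 = d - 1 := by have := (a i).2; omega
      have hg := xprod_geom d n i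
      have hd' : d = (d - 1) + 1 := by omega
      have hr : Finset.range d = Finset.range ((d - 1) + 1) := by rw [← hd']
      rw [hr, Finset.sum_range_succ, ← Fin.sum_univ_eq_sum_range (fun k => xS d n i ^ k)] at hg
      have : xS d n i * bS d n a = -∑ k : Fin (d - 1), bS d n (Function.update a i k) := by
        simp only [prod_update]
        rw [ha, ← hQ, ← Finset.mul_sum, ← Finset.sum_mul]
        have hg' : xprodS d n * (∑ k : Fin (d - 1), xS d n i ^ (k : ℕ)) +
          xprodS d n * (xS d n i ^ (a i : ℕ) * xS d n i) = 0 := by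
          rw [← mul_add, ← pow_succ, h1]; exact hg
        linear_combination Q * hg'
      rw [this]
      exact neg_mem (sum_mem fun k _ => Submodule.subset_span ⟨_, rfl⟩)

theorem mul_mem_span (d n : ℕ) (hd : 1 < d) (s m : Sring d n)
    (hm : m ∈ Submodule.span ℤ (Set.range (bS d n))) :
    s * m ∈ Submodule.span ℤ (Set.range (bS d n)) := by
  have hs : s ∈ Algebra.adjoin ℤ (Set.range (xS d n)) := by
    rw [adjoin_xS d n hd]; trivial
  induction hs using Algebra.adjoin_induction generalizing m with
  | mem x hx => obtain ⟨i, rfl⟩ := hx; exact xS_mul_mem d n hd i m hm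
  | algebraMap r =>
    rw [← Algebra.smul_def]; exact Submodule.smul_mem _ _ hm
  | add x y _ _ hx hy => rw [add_mul]; exact add_mem (hx m hm) (hy m hm)
  | mul x y _ _ hx hy => rw [mul_assoc]; exact hx _ (hy m hm)

theorem mem_span_iff (d n : ℕ) (hd : 1 < d) (s : Sring d n) (hs : s ∈ Ideal.span {xprodS d n}) :
    s ∈ Submodule.span ℤ (Set.range (bS d n)) := by
  obtain ⟨t, rfl⟩ := Ideal.mem_span_singleton'.1 hs
  apply mul_mem_span d n hd
  refine Submodule.subset_span ⟨fun _ => ⟨0, by omega⟩, ?_⟩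
  simp [bS]

theorem exists_char (d n : ℕ) (hd : 1 < d) (z : Fin (n + 1) → ℂ) (hz : ∀ i, z i ^ d = 1) :
    ∃ f : Sring d n →+* ℂ, ∀ i, f (xS d n i) = z i := by
  let w : Fin (n + 1) → ℂ := fun i =>
    Fin.induction (motive := fun _ => ℂ) (z 0) (fun i w => w * z i.succ) i
  have hw0 : w 0 = z 0 := rfl
  have hws : ∀ i : Fin n, w i.succ = w i.castSucc * z i.succ := fun i => by
    simp only [w, Fin.induction_succ]
  have hw : ∀ i, w i ^ d = 1 := by
    intro i
    induction i using Fin.induction with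
    | zero => rw [hw0, hz]
    | succ i ih => rw [hws, mul_pow, ih, hz, one_mul]
  let f : Sring d n →+* ℂ := Ideal.Quotient.lift _ (MvPolynomial.eval₂Hom (Int.castRingHom ℂ) w) (by
    intro a ha
    have : Ideal.span (Set.range fun i : Fin (n + 1) =>
      (MvPolynomial.X i : MvPolynomial (Fin (n + 1)) ℤ) ^ d - 1) ≤
        RingHom.ker (MvPolynomial.eval₂Hom (Int.castRingHom ℂ) w) := by
      rw [Ideal.span_le]
      rintro _ ⟨i, rfl⟩
      simp [RingHom.mem_ker, hw]
    exact this ha)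
  have hf : ∀ i, f (yS d n i) = w i := fun i => by
    exact (Ideal.Quotient.lift_mk _ _ _).trans (by simp)
  refine ⟨f, fun i => ?_⟩
  refine Fin.cases ?_ (fun i => ?_) i
  · exact hf 0
  · change f (yS d n i.succ * (yS d n i.castSucc) ^ (d - 1)) = _
    rw [map_mul, map_pow, hf, hf, hws]
    have h := hw i.castSucc
    obtain ⟨e, rfl⟩ : ∃ e, d = e + 1 := ⟨d - 1, by omega⟩
    rw [Nat.add_sub_cancel]
    rw [pow_succ] at h
    linear_combination z i.succ * h

theorem bS_indep (d n : ℕ) (hd : 1 < d) (c : (Fin (n + 1) → Fin (d - 1)) → ℤ)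
    (hc : ∑ a, c a • bS d n a = 0) (a : Fin (n + 1) → Fin (d - 1)) : c a = 0 := by
  classical
  let e : (Fin (n + 1) → Fin (d - 1)) → (Fin (n + 1) →₀ ℕ) := fun a =>
    Finsupp.equivFunOnFinite.symm fun i => (a i : ℕ)
  have he : Function.Injective e := by
    intro a b h
    funext i
    exact Fin.ext (DFunLike.congr_fun h i)
  let p : MvPolynomial (Fin (n + 1)) ℂ := ∑ a, MvPolynomial.monomial (e a) (c a : ℂ)
  let T : Finset ℂ := (Polynomial.nthRootsFinset d (1 : ℂ)).erase 1
  have hT : T.card = d - 1 := by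
    rw [Finset.card_erase_of_mem, (Complex.isPrimitiveRoot_exp d (by omega)).card_nthRootsFinset]
    rw [Polynomial.mem_nthRootsFinset (by omega)]; simp
  have hp : p = 0 := by
    refine MvPolynomial.eq_zero_of_eval_zero_at_prod_finset p (fun _ => T) ?_ ?_
    · intro i
      rw [hT]
      rw [MvPolynomial.degreeOf_lt_iff (by omega)]
      intro m hm
      obtain ⟨a, -, ha⟩ := Finset.mem_biUnion.1 (MvPolynomial.support_sum hm)
      have := Finset.mem_singleton.1 (MvPolynomial.support_monomial_subset ha)
      rw [this]
      exact (a i).2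
    · intro z hz
      have hz1 : ∀ i, z i ≠ 1 := fun i => (Finset.mem_erase.1 (hz i)).1
      have hzd : ∀ i, z i ^ d = 1 := fun i =>
        (Polynomial.mem_nthRootsFinset (by omega) _).1 (Finset.mem_erase.1 (hz i)).2
      obtain ⟨f, hf⟩ := exists_char d n hd z hzd
      have h := congrArg f hc
      have hP : f (xprodS d n) ≠ 0 := by
        rw [xprodS_eq, map_prod, Finset.prod_ne_zero_iff]
        intro i _
        rw [map_sub, hf, map_one]
        exact sub_ne_zero.2 (hz1 i)
      have h2 : f (xprodS d n) * MvPolynomial.eval z p = 0 := by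
        rw [map_zero, map_sum] at h
        rw [← h, map_sum, Finset.mul_sum]
        refine Finset.sum_congr rfl fun a _ => ?_
        rw [map_zsmul, bS, map_mul, map_prod, MvPolynomial.eval_monomial, Finsupp.prod_fintype _ _ (by simp)]
        simp only [map_pow, hf, zsmul_eq_mul, e, Finsupp.equivFunOnFinite_symm_apply_apply]
        ring
      exact (mul_eq_zero.1 h2).resolve_left hP
  have := congrArg (MvPolynomial.coeff (e a)) hp
  simp only [p, MvPolynomial.coeff_sum, MvPolynomial.coeff_monomial, he.eq_iff,
    MvPolynomial.coeff_zero] at this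
  simpa using this

/-- The principal ideal of `S` generated by `(x_0 - 1)⋯(x_n - 1)` is a free
`ℤ`-module of rank `(d-1)^{n+1}`. -/
theorem stmt12 (d n : ℕ) (hd : 1 < d) :
    Module.Free ℤ ↥(Ideal.span {xprodS d n}) ∧
      Module.finrank ℤ ↥(Ideal.span {xprodS d n}) = (d - 1) ^ (n + 1) := by
  have hmem : ∀ a, bS d n a ∈ Ideal.span {xprodS d n} := fun a =>
    Ideal.mul_mem_right _ _ (Ideal.mem_span_singleton_self _)
  let v : (Fin (n + 1) → Fin (d - 1)) → ↥(Ideal.span {xprodS d n}) := fun a => ⟨bS d n a, hmem a⟩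
  have hli : LinearIndependent ℤ v := by
    rw [Fintype.linearIndependent_iff]
    intro c hc a
    refine bS_indep d n hd c ?_ a
    have := congrArg (Submodule.subtype (Ideal.span {xprodS d n})) hc
    rw [map_sum, map_zero] at this
    rw [← this]
    refine Finset.sum_congr rfl fun a _ => ?_
    rw [map_zsmul]
    rfl
  have hsp : ⊤ ≤ Submodule.span ℤ (Set.range v) := by
    rintro ⟨s, hs⟩ -
    obtain ⟨c, hc⟩ := (Submodule.mem_span_range_iff_exists_fun ℤ).1 (mem_span_iff d n hd s hs)
    refine (Submodule.mem_span_range_iff_exists_fun ℤ).2 ⟨c, ?_⟩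
    apply Subtype.ext
    change Submodule.subtype (Ideal.span {xprodS d n}) _ = s
    rw [← hc, map_sum]
    refine Finset.sum_congr rfl fun a _ => ?_
    rw [map_zsmul]
    rfl
  let B := Module.Basis.mk hli hsp
  refine ⟨Module.Free.of_basis B, ?_⟩
  rw [Module.finrank_eq_card_basis B]
  simp
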